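/- arXiv:2410.05832 — 6 statements merged into one kernel-verified Lean document; each statement's English description precedes it below -/
import Mathlib

section
/- The relation C on M is a C-relation; that is, it satisfies the four C-relation axioms of Adeleke–Neumann: (C1) for all a, b, c ∈ M, C(a; b, c) implies C(a; c, b); (C2) for all a, b, c ∈ M, C(a; b, c) implies ¬C(b; a, c); (C3) for all a, b, c, d ∈ M, C(a; b, c) implies C(a; d, c) or C(d; b, c); (C4) for all a, b ∈ M, if a ≠ b then C(a; b, b). -/
/-- The domain of `M_{C,lev}`: finitely supported functions `ℚ → ℕ`. -/
abbrev MClev : Type := ℚ →₀ ℕ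

/-- For `a ≠ b`, the minimum of the (finite nonempty) set `{i : ℚ | a i ≠ b i}`,
computed in `WithTop ℚ` (it is `⊤` iff `a = b`). -/
def meet (a b : MClev) : WithTop ℚ :=
  ((a.support ∪ b.support).filter (fun i => a i ≠ b i)).min

/-- The ternary relation `C(a; b, c)` on `M_{C,lev}`. -/
def Crel (a b c : MClev) : Prop :=
  (b = c ∧ a ≠ b) ∨ (a ≠ b ∧ a ≠ c ∧ b ≠ c ∧ meet a b < meet b c)

/-- The quaternary relation `V(a, b; c, d)` on `M_{C,lev}`. -/
def Vrel (a b c d : MClev) : Prop :=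
  a ≠ b ∧ c ≠ d ∧ meet a b ≤ meet c d

/-- An automorphism of `(M, C, V)`. -/
def IsAut (g : MClev → MClev) : Prop :=
  Function.Bijective g ∧
  (∀ a b c : MClev, Crel a b c ↔ Crel (g a) (g b) (g c)) ∧
  (∀ a b c d : MClev, Vrel a b c d ↔ Vrel (g a) (g b) (g c) (g d))

/-- A partial isomorphism with domain `A`. -/
def IsPartialIso (A : Set MClev) (f : MClev → MClev) : Prop :=
  Set.InjOn f A ∧
  (∀ a ∈ A, ∀ b ∈ A, ∀ c ∈ A, (Crel a b c ↔ Crel (f a) (f b) (f c))) ∧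
  (∀ a ∈ A, ∀ b ∈ A, ∀ c ∈ A, ∀ d ∈ A,
    (Vrel a b c d ↔ Vrel (f a) (f b) (f c) (f d)))

theorem le_meet_iff {x : WithTop ℚ} {a b : MClev} :
    x ≤ meet a b ↔ ∀ i : ℚ, a i ≠ b i → x ≤ i := by
  constructor
  · intro h i hi
    refine h.trans (Finset.min_le ?_)
    simp only [Finset.mem_filter, Finset.mem_union, Finsupp.mem_support_iff]
    exact ⟨by by_contra! hab; exact hi (hab.1.trans hab.2.symm), hi⟩
  · intro h
    exact Finset.le_min fun i hi => h i (Finset.mem_filter.mp hi).2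

theorem meet_comm (a b : MClev) : meet a b = meet b a :=
  eq_of_forall_le_iff fun x => by simp only [le_meet_iff, ne_comm]

theorem meet_eq_top_iff {a b : MClev} : meet a b = ⊤ ↔ a = b := by
  rw [← top_le_iff, le_meet_iff, Finsupp.ext_iff]
  simp

/-- The ultrametric inequality for `meet`. -/
theorem min_meet_le (a b c : MClev) : min (meet a b) (meet b c) ≤ meet a c := by
  rw [le_meet_iff]
  intro i hi
  by_cases hab : a i = b i
  · exact (min_le_right _ _).trans (le_meet_iff.mp le_rfl i (hab ▸ hi))
  · exact (min_le_left _ _).trans (le_meet_iff.mp le_rfl i hab)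

theorem Crel_iff_meet_lt {a b c : MClev} : Crel a b c ↔ meet a b < meet b c := by
  constructor
  · rintro (⟨rfl, hab⟩ | ⟨-, -, -, h⟩)
    · rw [meet_eq_top_iff.mpr (rfl : b = b), lt_top_iff_ne_top]
      exact mt meet_eq_top_iff.mp hab
    · exact h
  · intro h
    have hab : a ≠ b := fun e => h.ne_top (meet_eq_top_iff.mpr e)
    by_cases hbc : b = c
    · exact Or.inl ⟨hbc, hab⟩
    · refine Or.inr ⟨hab, ?_, hbc, h⟩
      rintro rfl
      exact h.ne (meet_comm a b)

/-- `C` is a C-relation on `M_{C,lev}`, i.e. it satisfies the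
Adeleke–Neumann axioms (C1)–(C4). -/
theorem Crel_is_C_relation :
    (∀ a b c : MClev, Crel a b c → Crel a c b) ∧
    (∀ a b c : MClev, Crel a b c → ¬ Crel b a c) ∧
    (∀ a b c d : MClev, Crel a b c → Crel a d c ∨ Crel d b c) ∧
    (∀ a b : MClev, a ≠ b → Crel a b b) := by
  simp only [Crel_iff_meet_lt]
  refine ⟨fun a b c h => ?_, fun a b c h h' => ?_, fun a b c d h => ?_, fun a b h => ?_⟩
  · have := min_meet_le a c b
    rw [meet_comm c b] at this ⊢
    exact (min_le_iff.mp this).elim (fun h' => h'.trans_lt h) fun h' => absurd h h'.not_gt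
  · have := min_meet_le a c b
    rw [meet_comm c b] at this
    rw [meet_comm b a] at h'
    exact this.not_gt (lt_min h' h)
  · by_contra! hn
    obtain ⟨hdc, hbc⟩ := hn
    have hd : meet b c ≤ meet d c := (le_min hbc le_rfl).trans (min_meet_le d b c)
    exact h.not_ge ((le_min (hd.trans hdc) hbc).trans (min_meet_le a d b))
  · rw [meet_eq_top_iff.mpr (rfl : b = b), lt_top_iff_ne_top]
    exact mt meet_eq_top_iff.mp h
end

section
/- The structure M_{C,lev} = (M, C, V) is homogeneous: every partial isomorphism f between finite subsets of M extends to an automorphism of (M, C, V), i.e. there is an automorphism g of (M, C, V) with g a = f a for all a in the domain of f. -/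
/-- `s` is the graph of a finite partial map preserving the binary function `d`. -/
def PairwisePreserves {α γ : Type*} (d : α → α → γ) (s : Finset (α × α)) : Prop :=
  ∀ p ∈ s, ∀ q ∈ s, d p.1 q.1 = d p.2 q.2

theorem PairwisePreserves.swap {α γ : Type*} [DecidableEq α] {d : α → α → γ}
    {s : Finset (α × α)} (hs : PairwisePreserves d s) :
    PairwisePreserves d (s.image Prod.swap) := by
  intro p hp q hq
  obtain ⟨p', hp', rfl⟩ := Finset.mem_image.1 hp
  obtain ⟨q', hq', rfl⟩ := Finset.mem_image.1 hq
  exact (hs p' hp' q' hq').symm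

/-- Back and forth: on a countable type, the one-point extension property for finite partial maps
preserving `d` yields extensions to permutations preserving `d`. -/
theorem exists_equiv_of_extension {α γ : Type*} [Countable α] [DecidableEq α] (d : α → α → γ)
    (hd : ∀ a b c, d a b = d c c → a = b)
    (hext : ∀ s : Finset (α × α), PairwisePreserves d s →
      ∀ a, ∃ b, PairwisePreserves d (insert (a, b) s))
    (s : Finset (α × α)) (hs : PairwisePreserves d s) :
    ∃ g : α ≃ α, (∀ a b, d (g a) (g b) = d a b) ∧ ∀ p ∈ s, g p.1 = p.2 := by
  have hext' : ∀ s : Finset (α × α), PairwisePreserves d s →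
      ∀ b, ∃ a, PairwisePreserves d (insert (a, b) s) := by
    intro s hs b
    obtain ⟨a, ha⟩ := hext _ hs.swap b
    refine ⟨a, ?_⟩
    simpa [Finset.image_insert, Finset.image_image] using ha.swap
  cases nonempty_encodable α
  let P := {s : Finset (α × α) // PairwisePreserves d s}
  let D : α ⊕ α → Order.Cofinal P := Sum.elim
    (fun a => ⟨{t | ∃ b, (a, b) ∈ t.1}, fun t => by
      obtain ⟨b, hb⟩ := hext t.1 t.2 a
      exact ⟨⟨_, hb⟩, ⟨b, Finset.mem_insert_self _ _⟩, Finset.subset_insert _ _⟩⟩)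
    (fun b => ⟨{t | ∃ a, (a, b) ∈ t.1}, fun t => by
      obtain ⟨a, ha⟩ := hext' t.1 t.2 b
      exact ⟨⟨_, ha⟩, ⟨a, Finset.mem_insert_self _ _⟩, Finset.subset_insert _ _⟩⟩)
  let I : Order.Ideal P := Order.idealOfCofinals ⟨s, hs⟩ D
  have hI : ∀ t ∈ I, ∀ t' ∈ I, ∀ p ∈ t.1, ∀ q ∈ t'.1, d p.1 q.1 = d p.2 q.2 := by
    intro t ht t' ht' p hp q hq
    obtain ⟨m, -, h, h'⟩ := I.directed _ ht _ ht'
    exact m.2 p (h hp) q (h' hq)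
  have hl : ∀ a, ∃ b, ∃ t ∈ I, (a, b) ∈ t.1 := by
    intro a
    obtain ⟨t, ⟨b, hb⟩, ht⟩ := Order.cofinal_meets_idealOfCofinals ⟨s, hs⟩ D (Sum.inl a)
    exact ⟨b, t, ht, hb⟩
  have hr : ∀ b, ∃ a, ∃ t ∈ I, (a, b) ∈ t.1 := by
    intro b
    obtain ⟨t, ⟨a, ha⟩, ht⟩ := Order.cofinal_meets_idealOfCofinals ⟨s, hs⟩ D (Sum.inr b)
    exact ⟨a, t, ht, ha⟩
  choose F TF hF hFm using hl
  choose G TG hG hGm using hr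
  refine ⟨⟨F, G, fun a => ?_, fun b => ?_⟩, fun a b => ?_, fun p hp => ?_⟩
  · exact hd _ _ _ (hI _ (hG _) _ (hF _) _ (hGm (F a)) _ (hFm a))
  · exact hd _ _ _ (hI _ (hF _) _ (hG _) _ (hFm (G b)) _ (hGm b)).symm
  · exact (hI _ (hF a) _ (hF b) _ (hFm a) _ (hFm b)).symm
  · exact hd _ _ _ (hI _ (hF _) _ (Order.mem_idealOfCofinals _ D) _ (hFm p.1) p hp).symm

theorem exists_orderIso_rat_of_finset (s : Finset (ℚ × ℚ)) (hs : PairwisePreserves cmp s) :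
    ∃ σ : ℚ ≃o ℚ, ∀ p ∈ s, σ p.1 = p.2 := by
  obtain ⟨g, hg, hgs⟩ := exists_equiv_of_extension (cmp : ℚ → ℚ → Ordering)
    (fun a b c h => by rwa [cmp_self_eq_eq, cmp_eq_eq_iff] at h)
    (fun s hs a => by
      obtain ⟨b, hb⟩ := Order.PartialIso.exists_across (⟨s, hs⟩ : Order.PartialIso ℚ ℚ) a
      refine ⟨b, fun p hp q hq => ?_⟩
      rw [Finset.mem_insert] at hp hq
      rcases hp with rfl | hp <;> rcases hq with rfl | hq
      · simp
      · exact cmp_eq_cmp_symm.2 (hb q hq)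
      · exact hb p hp
      · exact hs p hp q hq) s hs
  refine ⟨⟨g, fun {a b} => ?_⟩, hgs⟩
  exact le_iff_le_of_cmp_eq_cmp (hg a b)

theorem coe_le_meet_iff {i : ℚ} {a b : MClev} :
    (i : WithTop ℚ) ≤ meet a b ↔ ∀ j < i, a j = b j := by
  unfold meet
  rw [Finset.le_min_iff]
  constructor
  · intro h j hj
    by_contra hne
    have := h j (by
      simp only [Finset.mem_filter, Finset.mem_union, Finsupp.mem_support_iff]
      exact ⟨by by_contra! h0; exact hne (h0.1.trans h0.2.symm), hne⟩)
    exact absurd (WithTop.coe_le_coe.1 this) (not_le.2 hj)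
  · intro h j hj
    rw [WithTop.coe_le_coe]
    by_contra! hlt
    exact (Finset.mem_filter.1 hj).2 (h j hlt)

theorem meet_le_coe {i : ℚ} {a b : MClev} (h : a i ≠ b i) : meet a b ≤ i := by
  refine Finset.min_le ?_
  simp only [Finset.mem_filter, Finset.mem_union, Finsupp.mem_support_iff]
  exact ⟨by by_contra! h0; exact h (h0.1.trans h0.2.symm), h⟩

theorem meet_eq_coe_iff {i : ℚ} {a b : MClev} :
    meet a b = i ↔ a i ≠ b i ∧ ∀ j < i, a j = b j := by
  constructor
  · intro h
    refine ⟨?_, coe_le_meet_iff.1 h.ge⟩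
    exact (Finset.mem_filter.1 (Finset.mem_of_min h)).2
  · rintro ⟨h, h'⟩
    exact le_antisymm (meet_le_coe h) (coe_le_meet_iff.2 h')

theorem meet_self (a : MClev) : meet a a = ⊤ := meet_eq_top_iff.2 rfl

theorem meet_eq_of_lt {a b c : MClev} (h : meet a b < meet b c) : meet a c = meet a b := by
  obtain ⟨i, hi⟩ := WithTop.ne_top_iff_exists.1 h.ne_top
  rw [← hi] at h ⊢
  obtain ⟨hne, heq⟩ := meet_eq_coe_iff.1 hi.symm
  have hbc : b i = c i := by
    by_contra hbc
    exact absurd (meet_le_coe hbc) (not_le.2 h)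
  exact meet_eq_coe_iff.2
    ⟨hbc ▸ hne, fun j hj => (heq j hj).trans (coe_le_meet_iff.1 h.le j hj)⟩

theorem exists_agree_below_and_apply_eq (b : MClev) (i : ℚ) (v : ℕ) :
    ∃ c : MClev, (∀ j < i, c j = b j) ∧ c i = v := by
  refine ⟨b.filter (· < i) + Finsupp.single i v, fun j hj => ?_, ?_⟩
  · simp [hj, hj.ne']
  · simp

theorem exists_meet_extension (s : Finset (MClev × MClev)) (hs : PairwisePreserves meet s)
    (a : MClev) : ∃ b, PairwisePreserves meet (insert (a, b) s) := by
  suffices h : ∃ b, ∀ p ∈ s, meet p.1 a = meet p.2 b by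
    obtain ⟨b, hb⟩ := h
    refine ⟨b, fun p hp q hq => ?_⟩
    rw [Finset.mem_insert] at hp hq
    rcases hp with rfl | hp <;> rcases hq with rfl | hq
    · simp [meet_self]
    · rw [meet_comm, hb q hq, meet_comm]
    · exact hb p hp
    · exact hs p hp q hq
  rcases s.eq_empty_or_nonempty with rfl | hne
  · exact ⟨a, by simp⟩
  obtain ⟨q, hq, hmax⟩ := s.exists_max_image (fun p => meet p.1 a) hne
  rcases eq_or_ne (meet q.1 a) ⊤ with htop | htop
  · obtain rfl := meet_eq_top_iff.1 htop
    exact ⟨q.2, fun p hp => hs p hp q hq⟩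
  obtain ⟨i, hi⟩ := WithTop.ne_top_iff_exists.1 htop
  obtain ⟨v, hv⟩ := Infinite.exists_notMem_finset (s.image fun p => p.2 i)
  obtain ⟨b, hb, hbi⟩ := exists_agree_below_and_apply_eq q.2 i v
  have hvne : ∀ p ∈ s, p.2 i ≠ b i := fun p hp h =>
    hv (Finset.mem_image.2 ⟨p, hp, h.trans hbi⟩)
  have hqb : meet q.2 b = i := meet_eq_coe_iff.2 ⟨hvne q hq, fun j hj => (hb j hj).symm⟩
  refine ⟨b, fun p hp => ?_⟩
  have hle := hmax p hp
  rcases hle.lt_or_eq with hlt | heq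
  · have h1 : meet p.1 q.1 = meet p.1 a := meet_eq_of_lt (by rwa [meet_comm a])
    rw [← h1, hs p hp q hq, eq_comm]
    refine meet_eq_of_lt ?_
    rw [← hs p hp q hq, h1, hqb, hi]
    exact hlt
  · rw [heq, ← hi, eq_comm]
    refine meet_eq_coe_iff.2 ⟨hvne p hp, fun j hj => ?_⟩
    have hpq : (i : WithTop ℚ) ≤ meet p.2 q.2 := by
      rw [← hs p hp q hq, coe_le_meet_iff]
      intro k hk
      exact (coe_le_meet_iff.1 (hi.le.trans heq.ge) k hk).trans
        (coe_le_meet_iff.1 hi.le k hk).symm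
    exact (coe_le_meet_iff.1 hpq j hj).trans (hb j hj).symm

theorem meet_equivMapDomain (σ : ℚ ≃o ℚ) (a b : MClev) :
    meet (a.equivMapDomain σ.toEquiv) (b.equivMapDomain σ.toEquiv) =
      σ.withTopCongr (meet a b) := by
  rcases eq_or_ne (meet a b) ⊤ with h | h
  · obtain rfl := meet_eq_top_iff.1 h
    simp [meet_self]
  obtain ⟨i, hi⟩ := WithTop.ne_top_iff_exists.1 h
  obtain ⟨hne, heq⟩ := meet_eq_coe_iff.1 hi.symm
  rw [← hi, OrderIso.withTopCongr_apply, WithTop.map_coe, meet_eq_coe_iff]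
  refine ⟨by simpa using hne, fun j hj => ?_⟩
  simp only [Finsupp.equivMapDomain_apply]
  exact heq _ (σ.symm_apply_lt.2 hj)

theorem isAut_of_meet (g : MClev ≃ MClev) (τ : WithTop ℚ ≃o WithTop ℚ)
    (h : ∀ a b, meet (g a) (g b) = τ (meet a b)) : IsAut g := by
  refine ⟨g.bijective, fun a b c => ?_, fun a b c d => ?_⟩
  · simp [Crel, h]
  · simp [Vrel, h]

theorem IsPartialIso.meet_le_meet_iff {A : Set MClev} {f : MClev → MClev}
    (hf : IsPartialIso A f) {a b c d : MClev} (ha : a ∈ A) (hb : b ∈ A) (hc : c ∈ A)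
    (hd : d ∈ A) (hab : a ≠ b) (hcd : c ≠ d) :
    meet a b ≤ meet c d ↔ meet (f a) (f b) ≤ meet (f c) (f d) := by
  have := hf.2.2 a ha b hb c hc d hd
  simpa [Vrel, hab, hcd, hf.1.ne ha hb hab, hf.1.ne hc hd hcd] using this

theorem IsPartialIso.exists_orderIso {A : Set MClev} {f : MClev → MClev}
    (hA : A.Finite) (hf : IsPartialIso A f) :
    ∃ σ : ℚ ≃o ℚ, ∀ a ∈ A, ∀ b ∈ A, meet (f a) (f b) = σ.withTopCongr (meet a b) := by
  let s : Finset (ℚ × ℚ) := hA.toFinset.offDiag.image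
    fun p => ((meet p.1 p.2).untopD 0, (meet (f p.1) (f p.2)).untopD 0)
  have hs : PairwisePreserves cmp s := by
    intro p hp q hq
    obtain ⟨⟨a, b⟩, hab, rfl⟩ := Finset.mem_image.1 hp
    obtain ⟨⟨c, d⟩, hcd, rfl⟩ := Finset.mem_image.1 hq
    simp only [Finset.mem_offDiag, Set.Finite.mem_toFinset] at hab hcd
    obtain ⟨ha, hb, hab⟩ := hab
    obtain ⟨hc, hd, hcd⟩ := hcd
    have h1 := hf.meet_le_meet_iff ha hb hc hd hab hcd
    have h2 := hf.meet_le_meet_iff hc hd ha hb hcd hab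
    obtain ⟨i, hi⟩ := WithTop.ne_top_iff_exists.1 (mt meet_eq_top_iff.1 hab)
    obtain ⟨j, hj⟩ := WithTop.ne_top_iff_exists.1 (mt meet_eq_top_iff.1 hcd)
    obtain ⟨k, hk⟩ := WithTop.ne_top_iff_exists.1 (mt meet_eq_top_iff.1 (hf.1.ne ha hb hab))
    obtain ⟨l, hl⟩ := WithTop.ne_top_iff_exists.1 (mt meet_eq_top_iff.1 (hf.1.ne hc hd hcd))
    simp only [← hi, ← hj, ← hk, ← hl, WithTop.coe_le_coe, WithTop.untopD_coe] at h1 h2 ⊢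
    rcases lt_trichotomy i j with h | h | h
    · rw [cmp_eq_lt_iff _ _ |>.2 h, eq_comm, cmp_eq_lt_iff]
      exact not_le.1 fun hlk => not_lt.2 (h2.2 hlk) h
    · rw [cmp_eq_eq_iff _ _ |>.2 h, eq_comm, cmp_eq_eq_iff]
      exact le_antisymm (h1.1 h.le) (h2.1 h.ge)
    · rw [cmp_eq_gt_iff _ _ |>.2 h, eq_comm, cmp_eq_gt_iff]
      exact not_le.1 fun hlk => not_lt.2 (h1.2 hlk) h
  obtain ⟨σ, hσ⟩ := exists_orderIso_rat_of_finset s hs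
  refine ⟨σ, fun a ha b hb => ?_⟩
  rcases eq_or_ne a b with rfl | hab
  · simp [meet_self]
  have := hσ _ (Finset.mem_image_of_mem _ (show (a, b) ∈ hA.toFinset.offDiag by simp [*]))
  obtain ⟨i, hi⟩ := WithTop.ne_top_iff_exists.1 (mt meet_eq_top_iff.1 hab)
  obtain ⟨k, hk⟩ := WithTop.ne_top_iff_exists.1 (mt meet_eq_top_iff.1 (hf.1.ne ha hb hab))
  simp only [← hi, ← hk, WithTop.untopD_coe] at this ⊢
  simp [this]

/-- `(M, C, V)` is homogeneous: every partial isomorphism between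
finite subsets of `M` extends to an automorphism of `(M, C, V)`. -/
theorem MClev_homogeneous (A : Set MClev) (hA : A.Finite) (f : MClev → MClev)
    (hf : IsPartialIso A f) :
    ∃ g : MClev → MClev, IsAut g ∧ ∀ a ∈ A, g a = f a := by
  obtain ⟨σ, hσ⟩ := hf.exists_orderIso hA
  let e : MClev ≃ MClev := Finsupp.equivCongrLeft σ.toEquiv
  have he : ∀ a b, meet (e a) (e b) = σ.withTopCongr (meet a b) := meet_equivMapDomain σ
  obtain ⟨g, hg, hgs⟩ := exists_equiv_of_extension meet
    (fun a b c h => meet_eq_top_iff.1 (h.trans (meet_self c))) exists_meet_extension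
    (hA.toFinset.image fun a => (e a, f a)) (by
      intro p hp q hq
      obtain ⟨a, ha, rfl⟩ := Finset.mem_image.1 hp
      obtain ⟨b, hb, rfl⟩ := Finset.mem_image.1 hq
      exact (he a b).trans (hσ a (hA.mem_toFinset.1 ha) b (hA.mem_toFinset.1 hb)).symm)
  refine ⟨e.trans g, isAut_of_meet _ σ.withTopCongr fun a b => (hg _ _).trans (he a b), ?_⟩
  intro a ha
  exact hgs _ (Finset.mem_image_of_mem _ (hA.mem_toFinset.2 ha))
end

section
/- For every n ≥ 2 and every permutation pattern σ of size n, there exists a σ-configuration in M; that is, there exist pairwise distinct elements a¹, a², a³, b₁,…,bₙ, c₁,…,cₙ of M satisfying conditions (1)–(4) of the definition of a σ-configuration. -/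
/-- A σ-configuration in `M_{C,lev}` for a permutation pattern
`σ = (lt1, lt2)` of size `n`: pairwise distinct elements
`a¹, a², a³, b₁, …, bₙ, c₁, …, cₙ` satisfying conditions (1)–(4). -/
def IsConfig {n : ℕ} (lt1 lt2 : Fin n → Fin n → Prop)
    (a : Fin 3 → MClev) (b c : Fin n → MClev) : Prop :=
  (Function.Injective a ∧ Function.Injective b ∧ Function.Injective c ∧
    (∀ (i : Fin 3) (j : Fin n), a i ≠ b j) ∧
    (∀ (i : Fin 3) (j : Fin n), a i ≠ c j) ∧
    (∀ i j : Fin n, b i ≠ c j)) ∧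
  (∀ i j k : Fin 3, i ≠ j → i ≠ k → j ≠ k → ¬ Crel (a i) (a j) (a k)) ∧
  (∀ (j : Fin 3) (i : Fin n), Crel (a j) (b i) (c i)) ∧
  (∀ (k : Fin 3) (i j : Fin n), lt1 i j → meet (a k) (b i) < meet (a k) (b j)) ∧
  (∀ i j : Fin n, lt2 i j → meet (b i) (c i) < meet (b j) (c j))

theorem meet_eq_coe {a b : MClev} {q : ℚ} (hq : a q ≠ b q) (h : ∀ i < q, a i = b i) :
    meet a b = q := by
  unfold meet
  apply le_antisymm
  · apply Finset.min_le
    simp only [Finset.mem_filter, Finset.mem_union, Finsupp.mem_support_iff]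
    refine ⟨?_, hq⟩
    by_contra! hz
    exact hq (hz.1.trans hz.2.symm)
  · refine Finset.le_min fun i hi => ?_
    rw [Finset.mem_filter] at hi
    exact WithTop.coe_le_coe.2 (not_lt.1 fun hlt => hi.2 (h i hlt))

theorem exists_nat_rank {n : ℕ} (lt : Fin n → Fin n → Prop) (h : IsStrictTotalOrder (Fin n) lt) :
    ∃ r : Fin n → ℕ, Function.Injective r ∧ (∀ i, r i < n) ∧ ∀ i j, lt i j → r i < r j := by
  classical
  have mono : ∀ i j, lt i j →
      (Finset.univ.filter (lt · i)).card < (Finset.univ.filter (lt · j)).card := by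
    intro i j hij
    apply Finset.card_lt_card
    rw [Finset.ssubset_iff_of_subset]
    · exact ⟨i, by simpa using hij, by simpa using irrefl_of lt i⟩
    · intro x hx
      simp only [Finset.mem_filter, Finset.mem_univ, true_and] at hx ⊢
      exact trans_of lt hx hij
  refine ⟨fun i => (Finset.univ.filter (lt · i)).card, fun i j hij => ?_, fun i => ?_, mono⟩
  · rcases trichotomous_of lt i j with hlt | heq | hgt
    · exact absurd hij (mono i j hlt).ne
    · exact heq
    · exact absurd hij (mono j i hgt).ne'
  · calc (Finset.univ.filter (lt · i)).card < (Finset.univ : Finset (Fin n)).card :=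
          Finset.card_lt_card (by
            rw [Finset.ssubset_iff_of_subset (Finset.filter_subset _ _)]
            exact ⟨i, Finset.mem_univ i, by simpa using irrefl_of lt i⟩)
      _ = n := by simp

/-- for every `n ≥ 2` and every permutation pattern `σ` of size
`n` (a pair of linear orders on `{1,…,n}`), there exists a σ-configuration in
`M_{C,lev}`. -/
theorem config_exists (n : ℕ) (hn : 2 ≤ n) (lt1 lt2 : Fin n → Fin n → Prop)
    (h1 : IsStrictTotalOrder (Fin n) lt1) (h2 : IsStrictTotalOrder (Fin n) lt2) :
    ∃ (a : Fin 3 → MClev) (b c : Fin n → MClev), IsConfig lt1 lt2 a b c := by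
  obtain ⟨r, hr_inj, hr_lt, hr_mono⟩ := exists_nat_rank lt1 h1
  obtain ⟨s, hs_inj, -, hs_mono⟩ := exists_nat_rank lt2 h2
  let a : Fin 3 → MClev := fun k => Finsupp.single (n : ℚ) (k : ℕ)
  let b : Fin n → MClev := fun i => Finsupp.single (r i : ℚ) 1
  let t : Fin n → ℚ := fun i => ((n + 1 + s i : ℕ) : ℚ)
  let c : Fin n → MClev := fun i => b i + Finsupp.single (t i) 1
  have hrn : ∀ i, (r i : ℚ) < n := fun i => Nat.cast_lt.2 (hr_lt i)
  have hnt : ∀ i, (n : ℚ) < t i := fun i => Nat.cast_lt.2 (by omega)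
  have hrt : ∀ i j, (r i : ℚ) < t j := fun i j => (hrn i).trans (hnt j)
  have a_apply : ∀ k q, q ≠ (n : ℚ) → a k q = 0 := fun k q hq => Finsupp.single_eq_of_ne hq
  have a_self : ∀ k, a k n = k := fun k => Finsupp.single_eq_same
  have b_apply : ∀ i q, q ≠ (r i : ℚ) → b i q = 0 := fun i q hq => Finsupp.single_eq_of_ne hq
  have b_self : ∀ i, b i (r i) = 1 := fun i => Finsupp.single_eq_same
  have c_eq_b : ∀ i q, q ≠ t i → c i q = b i q := fun i q hq => by
    simp [c, Finsupp.single_eq_of_ne hq]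
  have c_self : ∀ i, c i (t i) = 1 := fun i => by
    simp [c, b_apply i (t i) (hrt i i).ne']
  have meet_ab : ∀ k i, meet (a k) (b i) = (r i : ℚ) := fun k i =>
    meet_eq_coe (by rw [a_apply k _ (hrn i).ne, b_self]; exact zero_ne_one)
      fun q hq => by rw [a_apply k q (hq.trans (hrn i)).ne, b_apply i q hq.ne]
  have meet_bc : ∀ i, meet (b i) (c i) = t i := fun i =>
    meet_eq_coe (by rw [b_apply i _ (hrt i i).ne', c_self]; exact zero_ne_one)
      fun q hq => (c_eq_b i q hq.ne).symm
  have meet_aa : ∀ k l, k ≠ l → meet (a k) (a l) = (n : ℚ) := fun k l hkl =>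
    meet_eq_coe (by rw [a_self, a_self]; exact fun h => hkl (Fin.ext h))
      fun q hq => by rw [a_apply k q hq.ne, a_apply l q hq.ne]
  have a_inj : Function.Injective a := fun k l h => Fin.ext <| by
    rw [← a_self k, ← a_self l, h]
  have b_inj : Function.Injective b := fun i j h => by
    by_contra hij
    have hne : (r i : ℚ) ≠ r j := fun h' => hij (hr_inj (Nat.cast_injective h'))
    have := b_self i
    rw [h, b_apply j _ hne] at this
    exact zero_ne_one this
  have c_inj : Function.Injective c := fun i j h => by
    by_contra hij
    have hne : t i ≠ t j := fun h' => hij (hs_inj (Nat.add_left_cancel (Nat.cast_injective h')))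
    have := c_self i
    rw [h, c_eq_b j _ hne, b_apply j _ (hrt j i).ne'] at this
    exact zero_ne_one this
  have a_ne_b : ∀ k i, a k ≠ b i := fun k i h => by
    have := b_self i
    rw [← h, a_apply k _ (hrn i).ne] at this
    exact zero_ne_one this
  have a_ne_c : ∀ k i, a k ≠ c i := fun k i h => by
    have := c_self i
    rw [← h, a_apply k _ (hnt i).ne'] at this
    exact zero_ne_one this
  have b_ne_c : ∀ i j, b i ≠ c j := fun i j h => by
    have := c_self j
    rw [← h, b_apply i _ (hrt i j).ne'] at this
    exact zero_ne_one this
  refine ⟨a, b, c, ⟨a_inj, b_inj, c_inj, a_ne_b, a_ne_c, b_ne_c⟩, ?_, ?_, ?_, ?_⟩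
  · rintro i j k hij - hjk (⟨h, -⟩ | ⟨-, -, -, h⟩)
    · exact hjk (a_inj h)
    · rw [meet_aa i j hij, meet_aa j k hjk] at h
      exact lt_irrefl _ h
  · intro k i
    refine Or.inr ⟨a_ne_b k i, a_ne_c k i, b_ne_c i i, ?_⟩
    rw [meet_ab, meet_bc]
    exact WithTop.coe_lt_coe.2 (hrt i i)
  · intro k i j hij
    rw [meet_ab, meet_ab]
    exact WithTop.coe_lt_coe.2 (Nat.cast_lt.2 (hr_mono i j hij))
  · intro i j hij
    rw [meet_bc, meet_bc]
    exact WithTop.coe_lt_coe.2 (Nat.cast_lt.2 (Nat.add_lt_add_left (hs_mono i j hij) _))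
end

section
/- There exists K ∈ ℕ such that for every k ≥ K, the automorphism group of M_{C,lev} has at least ⌊k/3⌋! orbits on k-element subsets of M; precisely, for every k ≥ K there exists a family of ⌊k/3⌋! subsets of M, each of cardinality k, such that no automorphism of (M, C, V) maps one member of the family onto a different member. -/
theorem meet_eq_coe_s8 {a b : MClev} {i : ℚ} (hi : a i ≠ b i) (hlt : ∀ j < i, a j = b j) :
    meet a b = (i : WithTop ℚ) := by
  refine le_antisymm (Finset.min_le ?_) (Finset.le_min fun j hj => ?_)
  · simp only [Finset.mem_filter, Finset.mem_union, Finsupp.mem_support_iff]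
    exact ⟨by by_contra! h; exact hi (h.1.trans h.2.symm), hi⟩
  · rw [WithTop.coe_le_coe]
    by_contra! h
    exact (Finset.mem_filter.mp hj).2 (hlt j h)

/-- A map preserving `V` preserves the meets of a finite set `S` whenever the meets of the
target set already occur in `S`. -/
theorem meet_map_eq {S T : Finset MClev} {g : MClev → MClev} (hg : IsAut g)
    (hST : ∀ a ∈ S, g a ∈ T)
    (hlev : ∀ a ∈ T, ∀ b ∈ T, a ≠ b → ∃ c ∈ S, ∃ d ∈ S, c ≠ d ∧ meet c d = meet a b)
    {a b : MClev} (ha : a ∈ S) (hb : b ∈ S) (hab : a ≠ b) :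
    meet (g a) (g b) = meet a b := by
  obtain ⟨hbij, -, hV⟩ := hg
  have hle : ∀ {a b c d : MClev}, a ≠ b → c ≠ d →
      (meet a b ≤ meet c d ↔ meet (g a) (g b) ≤ meet (g c) (g d)) := by
    intro a b c d h h'
    have := hV a b c d
    simpa only [Vrel, h, h', hbij.1.ne h, hbij.1.ne h', ne_eq, not_false_eq_true,
      true_and] using this
  let L : Set (WithTop ℚ) := {l | ∃ c ∈ S, ∃ d ∈ S, c ≠ d ∧ meet c d = l}
  have hfin : L.Finite := by
    refine ((S ×ˢ S).image fun p => meet p.1 p.2).finite_toSet.subset ?_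
    rintro l ⟨c, hc, d, hd, -, rfl⟩
    simp only [Finset.coe_image, Set.mem_image, Finset.mem_coe, Finset.mem_product]
    exact ⟨(c, d), ⟨hc, hd⟩, rfl⟩
  have : Finite L := hfin
  have hex : ∀ l : L, ∃ l' : L, ∀ c ∈ S, ∀ d ∈ S, c ≠ d → meet c d = l →
      meet (g c) (g d) = l' := by
    rintro ⟨l, c, hc, d, hd, hcd, rfl⟩
    refine ⟨⟨meet (g c) (g d), hlev _ (hST c hc) _ (hST d hd) (hbij.1.ne hcd)⟩, ?_⟩
    intro c' _ d' _ hcd' h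
    exact le_antisymm ((hle hcd' hcd).1 h.le) ((hle hcd hcd').1 h.ge)
  choose f hf using hex
  have hmono : StrictMono f := by
    rintro ⟨l, c, hc, d, hd, hcd, rfl⟩ ⟨l', c', hc', d', hd', hcd', rfl⟩ hlt
    rw [← Subtype.coe_lt_coe, ← hf _ c hc d hd hcd rfl, ← hf _ c' hc' d' hd' hcd' rfl]
    exact lt_of_not_ge fun h => absurd ((hle hcd' hcd).2 h) (not_le_of_gt hlt)
  let l : L := ⟨meet a b, a, ha, b, hb, hab, rfl⟩
  rw [hf l a ha b hb hab rfl]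
  exact congrArg Subtype.val (le_antisymm (hmono.apply_le (x := l)) (hmono.le_apply (x := l)))

/-- The points number `3 i`, `3 i + 1`, `3 i + 2` form the `i`-th branch: they separate from the
other branches at level `-1`, the first separates from the other two at level `i`, and these
separate at level `n + 1 + f i`. -/
noncomputable def branchPoint (n : ℕ) (f : ℕ → ℕ) (m : ℕ) : MClev :=
  Finsupp.single (-1) (m / 3) + Finsupp.single ((m / 3 : ℕ) : ℚ) (if m % 3 = 0 then 0 else 1) +
    Finsupp.single ((n + 1 + f (m / 3) : ℕ) : ℚ) (if m % 3 = 2 then 1 else 0)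

theorem branchPoint_apply (n : ℕ) (f : ℕ → ℕ) (m : ℕ) (q : ℚ) :
    branchPoint n f m q = (if -1 = q then m / 3 else 0) +
      (if ((m / 3 : ℕ) : ℚ) = q then (if m % 3 = 0 then 0 else 1) else 0) +
      (if ((n + 1 + f (m / 3) : ℕ) : ℚ) = q then (if m % 3 = 2 then 1 else 0) else 0) := by
  simp only [branchPoint, Finsupp.add_apply, Finsupp.single_apply]

theorem natCast_ne_of_lt_zero {q : ℚ} (hq : q < 0) (a : ℕ) : (a : ℚ) ≠ q :=
  (hq.trans_le a.cast_nonneg).ne'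

theorem meet_branchPoint_of_div_ne (n : ℕ) (f : ℕ → ℕ) {m m' : ℕ} (h : m / 3 ≠ m' / 3) :
    meet (branchPoint n f m) (branchPoint n f m') = ((-1 : ℚ) : WithTop ℚ) := by
  refine meet_eq_coe_s8 ?_ fun q hq => ?_
  · have := natCast_ne_of_lt_zero (q := -1) (by norm_num)
    simp only [branchPoint_apply, this, if_true, if_false]
    exact h
  · have := natCast_ne_of_lt_zero (q := q) (by linarith)
    simp only [branchPoint_apply, this, hq.ne', if_false]

theorem meet_branchPoint_of_mod_eq_zero {n : ℕ} (f : ℕ → ℕ) {m m' : ℕ} (hn : m / 3 ≤ n)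
    (h : m / 3 = m' / 3) (hm : m % 3 = 0) (hm' : m' % 3 ≠ 0) :
    meet (branchPoint n f m) (branchPoint n f m') = (((m / 3 : ℕ) : ℚ) : WithTop ℚ) := by
  have key : ∀ q : ℚ, q ≤ (m / 3 : ℕ) → ((n + 1 + f (m / 3) : ℕ) : ℚ) ≠ q := by
    intro q hq
    refine (hq.trans_lt ?_).ne'
    exact_mod_cast (by omega : m / 3 < n + 1 + f (m / 3))
  refine meet_eq_coe_s8 ?_ fun q hq => ?_
  · simp only [branchPoint_apply, ← h, key _ le_rfl, hm, hm', if_true, if_false]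
    omega
  · simp only [branchPoint_apply, ← h, key q hq.le, hq.ne', if_false]

theorem meet_branchPoint_of_mod_eq_one (n : ℕ) (f : ℕ → ℕ) {m m' : ℕ}
    (h : m / 3 = m' / 3) (hm : m % 3 = 1) (hm' : m' % 3 = 2) :
    meet (branchPoint n f m) (branchPoint n f m') =
      (((n + 1 + f (m / 3) : ℕ) : ℚ) : WithTop ℚ) := by
  refine meet_eq_coe_s8 ?_ fun q hq => ?_
  · simp only [branchPoint_apply, ← h, hm, hm', if_true]
    norm_num
  · simp only [branchPoint_apply, ← h, hm, hm', hq.ne', if_false]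
    norm_num

theorem meet_branchPoint {n : ℕ} (f : ℕ → ℕ) {m m' : ℕ} (hn : m / 3 ≤ n) (hne : m ≠ m') :
    meet (branchPoint n f m) (branchPoint n f m') =
      (((if m / 3 ≠ m' / 3 then -1 else if m % 3 = 0 ∨ m' % 3 = 0 then (m / 3 : ℕ)
        else (n + 1 + f (m / 3) : ℕ) : ℤ) : ℚ) : WithTop ℚ) := by
  by_cases h : m / 3 = m' / 3
  · rw [if_neg (not_not.2 h)]
    rcases (by omega : (m % 3 = 0 ∧ m' % 3 ≠ 0) ∨ (m' % 3 = 0 ∧ m % 3 ≠ 0) ∨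
      (m % 3 = 1 ∧ m' % 3 = 2) ∨ (m' % 3 = 1 ∧ m % 3 = 2)) with h' | h' | h' | h'
    · rw [meet_branchPoint_of_mod_eq_zero f hn h h'.1 h'.2, if_pos (Or.inl h'.1), Int.cast_natCast]
    · rw [meet_comm, meet_branchPoint_of_mod_eq_zero f (h ▸ hn) h.symm h'.1 h'.2,
        if_pos (Or.inr h'.1), h, Int.cast_natCast]
    · rw [meet_branchPoint_of_mod_eq_one n f h h'.1 h'.2, if_neg (by omega), Int.cast_natCast]
    · rw [meet_comm, meet_branchPoint_of_mod_eq_one n f h.symm h'.1 h'.2, if_neg (by omega), h,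
        Int.cast_natCast]
  · rw [if_pos h, meet_branchPoint_of_div_ne n f h]
    norm_num

theorem branchPoint_ne {n : ℕ} (f : ℕ → ℕ) {m m' : ℕ} (hn : m / 3 ≤ n) (hne : m ≠ m') :
    branchPoint n f m ≠ branchPoint n f m' := by
  intro h
  have := meet_branchPoint f hn hne
  rw [h, meet_self] at this
  exact WithTop.top_ne_coe this

/-- The first `k` branch points. -/
noncomputable def branchSet (k : ℕ) (f : ℕ → ℕ) : Finset MClev :=
  (Finset.range k).image (branchPoint (k / 3) f)

theorem mem_branchSet {k : ℕ} {f : ℕ → ℕ} {a : MClev} :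
    a ∈ branchSet k f ↔ ∃ m < k, branchPoint (k / 3) f m = a := by
  simp [branchSet]

theorem card_branchSet (k : ℕ) (f : ℕ → ℕ) : (branchSet k f).card = k := by
  rw [branchSet, Finset.card_image_of_injOn, Finset.card_range]
  intro m hm m' _ h
  by_contra hne
  have hm := Finset.mem_range.1 (Finset.mem_coe.1 hm)
  exact branchPoint_ne f (Nat.div_le_div_right hm.le) hne h

theorem exists_meet_eq_branchSet {k : ℕ} {f f' : ℕ → ℕ}
    (h : ∀ i < k / 3, ∃ j < k / 3, f' j = f i)
    {a b : MClev} (ha : a ∈ branchSet k f) (hb : b ∈ branchSet k f) (hab : a ≠ b) :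
    ∃ c ∈ branchSet k f', ∃ d ∈ branchSet k f', c ≠ d ∧ meet c d = meet a b := by
  simp only [mem_branchSet] at ha hb
  obtain ⟨m, hm, rfl⟩ := ha
  obtain ⟨m', hm', rfl⟩ := hb
  have hne : m ≠ m' := by rintro rfl; exact hab rfl
  suffices H : ∃ l < k, ∃ l' < k, l ≠ l' ∧ meet (branchPoint (k / 3) f' l)
      (branchPoint (k / 3) f' l') = meet (branchPoint (k / 3) f m) (branchPoint (k / 3) f m') by
    obtain ⟨l, hl, l', hl', hll, H⟩ := H
    exact ⟨_, mem_branchSet.2 ⟨l, hl, rfl⟩, _, mem_branchSet.2 ⟨l', hl', rfl⟩,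
      branchPoint_ne f' (Nat.div_le_div_right hl.le) hll, H⟩
  rw [meet_branchPoint f (Nat.div_le_div_right hm.le) hne]
  by_cases hc : m / 3 ≠ m' / 3 ∨ m % 3 = 0 ∨ m' % 3 = 0
  · refine ⟨m, hm, m', hm', hne, ?_⟩
    rw [meet_branchPoint f' (Nat.div_le_div_right hm.le) hne]
    congr 2
    split_ifs <;> first | rfl | omega
  · obtain ⟨j, hj, hjf⟩ := h (m / 3) (by omega)
    refine ⟨3 * j + 1, by omega, 3 * j + 2, by omega, by omega, ?_⟩
    rw [meet_branchPoint_of_mod_eq_one _ _ (by omega) (by omega) (by omega),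
      (by omega : (3 * j + 1) / 3 = j), hjf, if_neg (by omega), if_neg (by omega),
      Int.cast_natCast]

theorem eq_of_image_branchSet {k : ℕ} {f f' : ℕ → ℕ}
    (h : ∀ i < k / 3, ∃ j < k / 3, f j = f' i) {g : MClev → MClev} (hg : IsAut g)
    (him : g '' (branchSet k f : Set MClev) = branchSet k f') {i : ℕ} (hi : i < k / 3) :
    f i = f' i := by
  have hST : ∀ a ∈ branchSet k f, g a ∈ branchSet k f' := fun a ha => by
    rw [← Finset.mem_coe, ← him]
    exact Set.mem_image_of_mem g ha
  have hex : ∀ m < k, ∃ l < k, branchPoint (k / 3) f' l = g (branchPoint (k / 3) f m) :=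
    fun m hm => mem_branchSet.1 (hST _ (mem_branchSet.2 ⟨m, hm, rfl⟩))
  have hmeet : ∀ m m' l l', m < k → m' < k → l < k → m ≠ m' →
      branchPoint (k / 3) f' l = g (branchPoint (k / 3) f m) →
      branchPoint (k / 3) f' l' = g (branchPoint (k / 3) f m') →
      (if l / 3 ≠ l' / 3 then -1 else if l % 3 = 0 ∨ l' % 3 = 0 then (l / 3 : ℕ)
        else (k / 3 + 1 + f' (l / 3) : ℕ) : ℤ) =
      (if m / 3 ≠ m' / 3 then -1 else if m % 3 = 0 ∨ m' % 3 = 0 then (m / 3 : ℕ)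
        else (k / 3 + 1 + f (m / 3) : ℕ) : ℤ) := by
    intro m m' l l' hm hm' hl hne hlm hlm'
    have hab := branchPoint_ne f (Nat.div_le_div_right hm.le) hne
    have hll : l ≠ l' := by
      rintro rfl
      exact hab (hg.1.1 (hlm.symm.trans hlm'))
    have := meet_map_eq hg hST (fun a ha b hb hab => exists_meet_eq_branchSet h ha hb hab)
      (mem_branchSet.2 ⟨m, hm, rfl⟩) (mem_branchSet.2 ⟨m', hm', rfl⟩) hab
    rw [← hlm, ← hlm', meet_branchPoint f (Nat.div_le_div_right hm.le) hne,
      meet_branchPoint f' (Nat.div_le_div_right hl.le) hll] at this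
    exact_mod_cast this
  obtain ⟨x, hx, hgx⟩ := hex (3 * i) (by omega)
  obtain ⟨y, hy, hgy⟩ := hex (3 * i + 1) (by omega)
  obtain ⟨z, hz, hgz⟩ := hex (3 * i + 2) (by omega)
  have h1 := hmeet _ _ _ _ (by omega) (by omega) hx (by omega) hgx hgy
  have h2 := hmeet _ _ _ _ (by omega) (by omega) hy (by omega) hgy hgz
  rw [if_neg (by omega : ¬ (3 * i) / 3 ≠ (3 * i + 1) / 3),
    if_pos (by omega : (3 * i) % 3 = 0 ∨ (3 * i + 1) % 3 = 0)] at h1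
  rw [if_neg (by omega : ¬ (3 * i + 1) / 3 ≠ (3 * i + 2) / 3),
    if_neg (by omega : ¬ ((3 * i + 1) % 3 = 0 ∨ (3 * i + 2) % 3 = 0)),
    (by omega : (3 * i + 1) / 3 = i)] at h2
  have hyi : y / 3 = i := by split_ifs at h1 <;> omega
  rw [hyi] at h2
  split_ifs at h2 <;> omega

/-- there is `K` such that for every `k ≥ K` the automorphism
group of `M_{C,lev}` has at least `⌊k/3⌋!` orbits on `k`-element subsets of
`M`: there is a family of `⌊k/3⌋!` subsets of `M` of cardinality `k`, no one
of which is mapped onto a different one by an automorphism of `(M, C, V)`. -/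
theorem orbit_growth_factorial :
    ∃ K : ℕ, ∀ k : ℕ, K ≤ k →
      ∃ S : Fin (Nat.factorial (k / 3)) → Finset MClev,
        (∀ i, (S i).card = k) ∧
        (∀ i j, i ≠ j → ∀ g : MClev → MClev, IsAut g →
          g '' (S i : Set MClev) ≠ (S j : Set MClev)) := by
  refine ⟨0, fun k _ => ?_⟩
  let e : Fin (Nat.factorial (k / 3)) ≃ Equiv.Perm (Fin (k / 3)) :=
    (finCongr (by rw [Fintype.card_perm, Fintype.card_fin])).trans
      (Fintype.equivFin (Equiv.Perm (Fin (k / 3)))).symm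
  let F : Equiv.Perm (Fin (k / 3)) → ℕ → ℕ := fun σ i => if h : i < k / 3 then σ ⟨i, h⟩ else 0
  have hF : ∀ (σ : Equiv.Perm (Fin (k / 3))) (i : Fin (k / 3)), F σ i = σ i := fun σ i => by
    simp [F]
  refine ⟨fun s => branchSet k (F (e s)), fun s => card_branchSet k _, ?_⟩
  intro s t hst g hg him
  refine hst (e.injective (Equiv.ext fun i => Fin.ext ?_))
  rw [← hF, ← hF]
  refine eq_of_image_branchSet (fun i hi => ?_) hg him i.2
  refine ⟨(e s).symm (e t ⟨i, hi⟩), Fin.is_lt _, ?_⟩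
  rw [hF, Equiv.apply_symm_apply, ← hF]
end

section
/- M_{C,lev} fails endless indiscernible triviality: there exist a 3-element subset A of M, elements b, c ∈ M, and a sequence of pairs (bᵢ, cᵢ)_{i ∈ ℤ} of elements of M such that the sequence is Aut-indiscernible over A ∪ {b} and Aut-indiscernible over A ∪ {c}, but it is not Aut-indiscernible over A ∪ {b, c}. -/
/-- A sequence of pairs `(bᵢ, cᵢ)_{i ∈ ℤ}` is Aut-indiscernible over `S`:
any two strictly increasing tuples of indices of the same length are mapped to
each other by an automorphism of `(M, C, V)` fixing `S` pointwise. -/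
def IndiscOver (S : Set MClev) (bs cs : ℤ → MClev) : Prop :=
  ∀ k : ℕ, 1 ≤ k → ∀ idx jdx : Fin k → ℤ,
    StrictMono idx → StrictMono jdx →
    ∃ g : MClev → MClev, IsAut g ∧ (∀ s ∈ S, g s = s) ∧
      ∀ t : Fin k, g (bs (idx t)) = bs (jdx t) ∧ g (cs (idx t)) = cs (jdx t)

theorem coe_lt_meet_iff (a b : MClev) (r : ℚ) :
    (r : WithTop ℚ) < meet a b ↔ ∀ i ≤ r, a i = b i := by
  unfold meet
  rw [Finset.min_eq_inf_withTop, Finset.lt_inf_iff (WithTop.coe_lt_top r)]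
  constructor
  · intro h i hi
    by_contra hne
    have hmem : i ∈ (a.support ∪ b.support).filter (fun i => a i ≠ b i) := by
      simp only [Finset.mem_filter, Finset.mem_union, Finsupp.mem_support_iff]
      refine ⟨?_, hne⟩
      by_contra! h0
      exact hne (h0.1.trans h0.2.symm)
    exact absurd (WithTop.coe_lt_coe.1 (h i hmem)) (not_lt.2 hi)
  · intro h i hi
    refine WithTop.coe_lt_coe.2 (lt_of_not_ge fun hle => ?_)
    exact (Finset.mem_filter.1 hi).2 (h i hle)

theorem withTop_le_iff_forall_coe_lt (x y : WithTop ℚ) :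
    x ≤ y ↔ ∀ r : ℚ, (r : WithTop ℚ) < x → (r : WithTop ℚ) < y := by
  refine ⟨fun h r hr => hr.trans_le h, fun h => le_of_forall_lt fun z hz => ?_⟩
  lift z to ℚ using (hz.trans_le le_top).ne
  exact h z hz

/-- A bijection that transports meets along a surjection of the levels is an automorphism. -/
theorem isAut_of_coe_lt_meet_iff {g : MClev → MClev} (hg : Function.Bijective g) {φ : ℚ → ℚ}
    (hφ : Function.Surjective φ)
    (h : ∀ (a b : MClev) (r : ℚ), (r : WithTop ℚ) < meet a b ↔
      ((φ r : ℚ) : WithTop ℚ) < meet (g a) (g b)) : IsAut g := by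
  have hle : ∀ a b c d : MClev, meet a b ≤ meet c d ↔ meet (g a) (g b) ≤ meet (g c) (g d) := by
    intro a b c d
    rw [withTop_le_iff_forall_coe_lt, withTop_le_iff_forall_coe_lt]
    refine Iff.trans ?_ hφ.forall.symm
    exact forall_congr' fun r => imp_congr (h a b r) (h c d r)
  refine ⟨hg, fun a b c => ?_, fun a b c d => ?_⟩
  · simp only [Crel, ne_eq, hg.1.eq_iff, ← not_le, ← hle]
  · simp only [Vrel, ne_eq, hg.1.eq_iff, ← hle]

theorem IsAut.comp {f g : MClev → MClev} (hf : IsAut f) (hg : IsAut g) : IsAut (f ∘ g) :=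
  ⟨hf.1.comp hg.1, fun _ _ _ => (hg.2.1 _ _ _).trans (hf.2.1 _ _ _),
    fun _ _ _ _ => (hg.2.2 _ _ _ _).trans (hf.2.2 _ _ _ _)⟩

theorem isAut_equivMapDomain (φ : ℚ ≃o ℚ) :
    IsAut (fun a : MClev => Finsupp.equivMapDomain φ.toEquiv a) := by
  refine isAut_of_coe_lt_meet_iff (Finsupp.equivCongrLeft φ.toEquiv).bijective φ.surjective ?_
  intro a b r
  simp only [coe_lt_meet_iff, Finsupp.equivMapDomain_apply]
  constructor
  · intro h i hi
    exact h _ (φ.symm_apply_le.2 hi)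
  · intro h i hi
    simpa using h (φ i) (φ.monotone hi)

/-- Swap the values `0` and `1` at level `1`, within the cone of functions whose value at `0`
is `4`. -/
noncomputable def coneSwap (a : MClev) : MClev :=
  if a 0 = 4 then a.update 1 (Equiv.swap 0 1 (a 1)) else a

theorem coneSwap_apply (a : MClev) (i : ℚ) :
    coneSwap a i = if a 0 = 4 ∧ i = 1 then Equiv.swap 0 1 (a 1) else a i := by
  unfold coneSwap
  by_cases h : a 0 = 4 <;> by_cases hi : i = 1 <;> simp [h, hi, Finsupp.update_apply]

theorem coneSwap_involutive : Function.Involutive coneSwap := by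
  intro a
  ext i
  by_cases h : a 0 = 4 <;> by_cases hi : i = 1 <;> simp [coneSwap_apply, h, hi]

theorem coneSwap_eq_self {a : MClev} (h : a 0 ≠ 4) : coneSwap a = a := if_neg h

theorem isAut_coneSwap : IsAut coneSwap := by
  have key : ∀ (a b : MClev) (r : ℚ), (∀ i ≤ r, a i = b i) →
      ∀ i ≤ r, coneSwap a i = coneSwap b i := by
    intro a b r h i hi
    rw [coneSwap_apply, coneSwap_apply, h i hi]
    by_cases h1 : i = 1
    · subst h1
      rw [h 0 (zero_le_one.trans hi), h 1 hi]
    · simp [h1]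
  refine isAut_of_coe_lt_meet_iff coneSwap_involutive.bijective Function.surjective_id ?_
  intro a b r
  simp only [coe_lt_meet_iff, id]
  refine ⟨key a b r, fun h => ?_⟩
  simpa only [coneSwap_involutive _] using key _ _ r h

theorem exists_orderIso_fixing_Iic {y a b : ℚ} (ha : y < a) (hb : y < b) :
    ∃ ψ : ℚ ≃o ℚ, (∀ z ≤ y, ψ z = z) ∧ ψ a = b := by
  have ha' : 0 < a - y := sub_pos.2 ha
  have hb' : 0 < b - y := sub_pos.2 hb
  set s := (b - y) / (a - y) with hs
  have hs0 : 0 < s := div_pos hb' ha'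
  let f : ℚ → ℚ := fun z => if z ≤ y then z else y + (z - y) * s
  have hmono : StrictMono f := by
    intro u v huv
    simp only [f]
    split_ifs with h1 h2 h2
    · exact huv
    · have := mul_pos (sub_pos.2 (not_le.1 h2)) hs0
      linarith
    · linarith
    · have := mul_lt_mul_of_pos_right (sub_lt_sub_right huv y) hs0
      linarith
  have hsurj : Function.Surjective f := by
    intro w
    by_cases hw : w ≤ y
    · exact ⟨w, if_pos hw⟩
    · have hpos : 0 < (w - y) / s := div_pos (sub_pos.2 (not_le.1 hw)) hs0
      refine ⟨y + (w - y) / s, ?_⟩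
      simp only [f]
      rw [if_neg (by linarith)]
      field_simp
      ring
  refine ⟨hmono.orderIsoOfSurjective f hsurj, fun z hz => if_pos hz, ?_⟩
  change f a = b
  simp only [f]
  rw [if_neg (not_le.2 ha), hs]
  field_simp
  ring

theorem exists_orderIso_extending {m : ℚ} (k : ℕ) (x y : Fin k → ℚ) (hx : StrictMono x)
    (hy : StrictMono y) (hxm : ∀ t, m < x t) (hym : ∀ t, m < y t) :
    ∃ φ : ℚ ≃o ℚ, (∀ z ≤ m, φ z = z) ∧ ∀ t, φ (x t) = y t := by
  induction k with
  | zero => exact ⟨OrderIso.refl ℚ, fun _ _ => rfl, fun t => t.elim0⟩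
  | succ k ih =>
    obtain ⟨φ, hφm, hφ⟩ := ih (fun t => x t.castSucc) (fun t => y t.castSucc)
      (hx.comp Fin.strictMono_castSucc) (hy.comp Fin.strictMono_castSucc)
      (fun _ => hxm _) (fun _ => hym _)
    obtain ⟨l, hml, hly, hlφ, hlast⟩ : ∃ l, m ≤ l ∧ (∀ t : Fin k, y t.castSucc ≤ l) ∧
        l < φ (x (Fin.last k)) ∧ l < y (Fin.last k) := by
      rcases k with _ | k
      · refine ⟨m, le_rfl, fun t => t.elim0, ?_, hym _⟩
        have := φ.strictMono (hxm (Fin.last 0))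
        rwa [hφm m le_rfl] at this
      · refine ⟨y (Fin.last k).castSucc, (hym _).le, fun t => ?_, ?_, ?_⟩
        · exact hy.monotone (Fin.castSucc_le_castSucc_iff.2 (Fin.le_last t))
        · rw [← hφ (Fin.last k)]
          exact φ.strictMono (hx (Fin.castSucc_lt_last _))
        · exact hy (Fin.castSucc_lt_last _)
    obtain ⟨ψ, hψl, hψ⟩ := exists_orderIso_fixing_Iic hlφ hlast
    refine ⟨φ.trans ψ, fun z hz => ?_, fun t => ?_⟩
    · rw [OrderIso.trans_apply, hφm z hz, hψl z (hz.trans hml)]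
    · induction t using Fin.lastCases with
      | last => rw [OrderIso.trans_apply, hψ]
      | cast t => rw [OrderIso.trans_apply, hφ t, hψl _ (hly t)]

theorem exists_isAut_shifting_levels (k : ℕ) (idx jdx : Fin k → ℤ) (hi : StrictMono idx)
    (hj : StrictMono jdx) :
    ∃ g : MClev → MClev, IsAut g ∧ (∀ n : ℕ, g (Finsupp.single 0 n) = Finsupp.single 0 n) ∧
      g 0 = 0 ∧ ∀ t, g (Finsupp.single ((2 : ℚ) ^ idx t) 1) = Finsupp.single ((2 : ℚ) ^ jdx t) 1 := by
  have hpow : StrictMono fun n : ℤ => (2 : ℚ) ^ n := zpow_right_strictMono₀ one_lt_two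
  obtain ⟨φ, h0, hφ⟩ := exists_orderIso_extending (m := 0) k (fun t => (2 : ℚ) ^ idx t)
    (fun t => (2 : ℚ) ^ jdx t) (hpow.comp hi) (hpow.comp hj)
    (fun _ => zpow_pos two_pos _) (fun _ => zpow_pos two_pos _)
  refine ⟨_, isAut_equivMapDomain φ, fun n => ?_, ?_, fun t => ?_⟩
  · have h : φ.toEquiv 0 = 0 := h0 0 le_rfl
    rw [Finsupp.equivMapDomain_single, h]
  · exact Finsupp.equivMapDomain_zero
  · have h : φ.toEquiv ((2 : ℚ) ^ idx t) = (2 : ℚ) ^ jdx t := hφ t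
    rw [Finsupp.equivMapDomain_single, h]

theorem coneSwap_single_add_single :
    coneSwap (Finsupp.single 0 4 + Finsupp.single 1 1) = Finsupp.single 0 4 := by
  ext i
  by_cases hi : i = 1 <;> simp [coneSwap_apply, hi]

theorem not_indiscOver_of_meet_eq_one {S : Set MClev} {b c : MClev} (hb : b ∈ S) (hc : c ∈ S)
    (hbc : ∀ i < 1, b i = c i) (hne : b 1 ≠ c 1) :
    ¬ IndiscOver S (fun _ => 0) (fun i => Finsupp.single ((2 : ℚ) ^ i) 1) := by
  intro H
  obtain ⟨g, hg, hfix, hmap⟩ := H 1 le_rfl (fun _ => 0) (fun _ => 1)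
    (Subsingleton.strictMono _) (Subsingleton.strictMono _)
  obtain ⟨h0, h1⟩ := hmap 0
  have hV : Vrel 0 (Finsupp.single ((2 : ℚ) ^ (0 : ℤ)) 1) b c := by
    refine ⟨(Finsupp.single_ne_zero.2 one_ne_zero).symm, fun h => hne (by rw [h]), ?_⟩
    rw [withTop_le_iff_forall_coe_lt]
    simp only [coe_lt_meet_iff]
    intro r hr i hi
    refine hbc i (hi.trans_lt (lt_of_not_ge fun hle => ?_))
    simpa using hr 1 hle
  rw [hg.2.2] at hV
  simp only at h0 h1
  rw [h0, h1, hfix b hb, hfix c hc] at hV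
  refine hne ((coe_lt_meet_iff b c 1).1 (lt_of_lt_of_le ?_ hV.2.2) 1 le_rfl)
  rw [coe_lt_meet_iff]
  intro i hi
  rw [Finsupp.single_eq_of_ne]
  · rfl
  · rintro rfl
    norm_num at hi

/-- `M_{C,lev}` fails endless indiscernible triviality: there
are a 3-element set `A ⊆ M`, elements `b, c`, and a sequence of pairs
`(bᵢ, cᵢ)_{i ∈ ℤ}` which is Aut-indiscernible over `A ∪ {b}` and over
`A ∪ {c}` but not over `A ∪ {b, c}`. -/
theorem fails_endless_indiscernible_triviality :
    ∃ (A : Finset MClev), A.card = 3 ∧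
      ∃ (b c : MClev) (bs cs : ℤ → MClev),
        IndiscOver ((A : Set MClev) ∪ {b}) bs cs ∧
        IndiscOver ((A : Set MClev) ∪ {c}) bs cs ∧
        ¬ IndiscOver ((A : Set MClev) ∪ {b, c}) bs cs := by
  refine ⟨({1, 2, 3} : Finset ℕ).map ⟨Finsupp.single 0, Finsupp.single_injective 0⟩,
    (Finset.card_map _).trans rfl,
    Finsupp.single 0 4, Finsupp.single 0 4 + Finsupp.single 1 1, fun _ => 0,
    fun i => Finsupp.single ((2 : ℚ) ^ i) 1, ?_, ?_, ?_⟩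
  · intro k _ idx jdx hi hj
    obtain ⟨g, hg, hsingle, h0, hmap⟩ := exists_isAut_shifting_levels k idx jdx hi hj
    refine ⟨g, hg, fun s hs => ?_, fun t => ⟨h0, hmap t⟩⟩
    simp only [Finset.coe_map, Set.mem_union, Set.mem_image, Set.mem_singleton_iff] at hs
    obtain ⟨n, -, rfl⟩ | rfl := hs <;> exact hsingle _
  · intro k _ idx jdx hi hj
    obtain ⟨g, hg, hsingle, h0, hmap⟩ := exists_isAut_shifting_levels k idx jdx hi hj
    have hcs : ∀ i : ℤ, coneSwap (Finsupp.single ((2 : ℚ) ^ i) 1) =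
        Finsupp.single ((2 : ℚ) ^ i) 1 := fun i => coneSwap_eq_self (by
      rw [Finsupp.single_eq_of_ne (zpow_ne_zero i two_ne_zero).symm]
      decide)
    have hzero : coneSwap 0 = 0 := coneSwap_eq_self (by simp)
    refine ⟨coneSwap ∘ g ∘ coneSwap, isAut_coneSwap.comp (hg.comp isAut_coneSwap),
      fun s hs => ?_, fun t => ⟨?_, ?_⟩⟩
    · have hfix : g (coneSwap s) = coneSwap s := by
        simp only [Finset.coe_map, Set.mem_union, Set.mem_image, Set.mem_singleton_iff] at hs
        obtain ⟨n, hn, rfl⟩ | rfl := hs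
        · have h4 : n ≠ 4 := by
            rintro rfl
            simp at hn
          have hself : coneSwap (Finsupp.single 0 n) = Finsupp.single 0 n :=
            coneSwap_eq_self (by simpa using h4)
          simp only [Function.Embedding.coeFn_mk, hself, hsingle]
        · rw [coneSwap_single_add_single, hsingle]
      simp only [Function.comp_apply, hfix, coneSwap_involutive s]
    · simp only [Function.comp_apply, hzero, h0]
    · simp only [Function.comp_apply, hcs, hmap]
  · refine not_indiscOver_of_meet_eq_one (b := Finsupp.single 0 4)
      (c := Finsupp.single 0 4 + Finsupp.single 1 1) (by simp) (by simp) (fun i hi => ?_) (by simp)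
    rw [Finsupp.add_apply, Finsupp.single_eq_of_ne hi.ne, add_zero]
end

section
/- Rigidity of Steiner systems: let n ≥ 3, let Ω be a set, and let 𝓛 be a Steiner (n−1)-system on Ω such that some line is a proper subset of Ω. Then there exist a finite subset A of Ω and a point p ∈ Ω \ A such that every automorphism of (Ω, 𝓛) that fixes A pointwise also fixes p. -/
/-- A Steiner `(n−1)`-system on `Ω`: a family of lines, each with at least `n`
elements, such that every `(n−1)`-element subset of `Ω` lies on exactly one
line. -/
def IsSteinerSystem (n : ℕ) {Ω : Type*} (L : Set (Set Ω)) : Prop :=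
  (∀ l ∈ L, (n : ℕ∞) ≤ l.encard) ∧
  (∀ s : Set Ω, s.encard = ((n - 1 : ℕ) : ℕ∞) → ∃! l, l ∈ L ∧ s ⊆ l)

/-- An automorphism of the Steiner system `(Ω, L)`. -/
def IsSteinerAut {Ω : Type*} (L : Set (Set Ω)) (g : Ω → Ω) : Prop :=
  Function.Bijective g ∧ ∀ l : Set Ω, l ∈ L ↔ g '' l ∈ L

namespace IsSteinerSystem

variable {n : ℕ} {Ω : Type*} {L : Set (Set Ω)}

theorem line_eq_of_subset (hL : IsSteinerSystem n L) {s : Finset Ω} (hs : s.card = n - 1)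
    {l m : Set Ω} (hl : l ∈ L) (hm : m ∈ L) (hsl : (s : Set Ω) ⊆ l) (hsm : (s : Set Ω) ⊆ m) :
    l = m :=
  (hL.2 s (by rw [Set.encard_coe_eq_coe_finsetCard, hs])).unique ⟨hl, hsl⟩ ⟨hm, hsm⟩

theorem apply_mem_line (hL : IsSteinerSystem n L) {s : Finset Ω} (hs : s.card = n - 1)
    {l : Set Ω} (hl : l ∈ L) (hsl : (s : Set Ω) ⊆ l) {g : Ω → Ω} (hg : IsSteinerAut L g)
    (hgs : ∀ x ∈ s, g x = x) {x : Ω} (hx : x ∈ l) : g x ∈ l := by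
  have h : g '' l = l := hL.line_eq_of_subset hs ((hg.2 l).1 hl) hl
    (fun y hy => ⟨y, hsl hy, hgs y hy⟩) hsl
  exact h ▸ Set.mem_image_of_mem g hx

theorem exists_finset_subset_line (hL : IsSteinerSystem n L) {l : Set Ω} (hl : l ∈ L) :
    ∃ s : Finset Ω, (s : Set Ω) ⊆ l ∧ s.card = n := by
  obtain ⟨t, htl, ht⟩ := Set.exists_subset_encard_eq (hL.1 l hl)
  have hfin : t.Finite := Set.finite_of_encard_eq_coe ht
  lift t to Finset Ω using hfin
  exact ⟨t, htl, by simpa using ht⟩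

theorem exists_mem_line_notMem (hL : IsSteinerSystem n L) {l : Set Ω} (hl : l ∈ L)
    {s : Finset Ω} (hs : s.card < n) : ∃ r ∈ l, r ∉ s := by
  obtain ⟨t, htl, ht⟩ := hL.exists_finset_subset_line hl
  obtain ⟨r, hrt, hrs⟩ := Finset.exists_mem_notMem_of_card_lt_card (hs.trans_eq ht.symm)
  exact ⟨r, htl hrt, hrs⟩

end IsSteinerSystem

/-- rigidity of Steiner systems: if `n ≥ 3` and `𝓛` is a Steiner
`(n−1)`-system on `Ω` with some line a proper subset of `Ω`, then there are a
finite set `A ⊆ Ω` and a point `p ∉ A` fixed by every automorphism of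
`(Ω, 𝓛)` fixing `A` pointwise. -/
theorem steiner_rigidity (n : ℕ) (hn : 3 ≤ n) (Ω : Type*) (L : Set (Set Ω))
    (hL : IsSteinerSystem n L) (hproper : ∃ l ∈ L, l ≠ Set.univ) :
    ∃ (A : Set Ω), A.Finite ∧ ∃ p : Ω, p ∉ A ∧
      ∀ g : Ω → Ω, IsSteinerAut L g → (∀ x ∈ A, g x = x) → g p = p := by
  classical
  obtain ⟨l, hl, hne⟩ := hproper
  obtain ⟨q, hq⟩ := (Set.ne_univ_iff_exists_notMem l).1 hne
  obtain ⟨k, rfl⟩ : ∃ k, n = k + 3 := ⟨n - 3, by omega⟩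
  obtain ⟨S, hSl, hS⟩ := hL.exists_finset_subset_line hl
  obtain ⟨p, S', hp, rfl, hS'⟩ := Finset.card_eq_succ.1 hS
  obtain ⟨x, S'', hx, rfl, hS''⟩ := Finset.card_eq_succ.1 hS'
  obtain ⟨y, F, hy, rfl, hF⟩ := Finset.card_eq_succ.1 hS''
  simp only [Finset.coe_insert, Set.insert_subset_iff] at hSl
  obtain ⟨hpl, hxl, hyl, hFl⟩ := hSl
  simp only [Finset.mem_insert, not_or] at hp hx
  have hqF : q ∉ F := fun h => hq (hFl h)
  have hqp : q ≠ p := fun h => hq (h ▸ hpl)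
  have hcard : ∀ {a b : Ω}, a ≠ b → a ∉ F → b ∉ F →
      (insert a (insert b F)).card = k + 3 - 1 := fun hab ha hb => by
    rw [Finset.card_insert_of_notMem (by simp [hab, ha]), Finset.card_insert_of_notMem hb, hF]
    rfl
  obtain ⟨m, ⟨hm, hsm⟩, -⟩ := hL.2 (insert q (insert p F) : Finset Ω)
    (by rw [Set.encard_coe_eq_coe_finsetCard, hcard hqp hqF hp.2.2])
  simp only [Finset.coe_insert, Set.insert_subset_iff] at hsm
  obtain ⟨hqm, hpm, hFm⟩ := hsm
  -- The lines `l` and `m` meet exactly in `F ∪ {p}`.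
  have hinter : ∀ z ∈ l, z ∈ m → z ∉ F → z = p := fun z hzl hzm hzF => by
    by_contra hzp
    refine hq (hL.line_eq_of_subset (hcard hzp hzF hp.2.2) hl hm ?_ ?_ ▸ hqm) <;>
      simp [Set.insert_subset_iff, *]
  obtain ⟨r, hrm, hr⟩ := hL.exists_mem_line_notMem hm (s := insert q (insert p F))
    (by rw [hcard hqp hqF hp.2.2]; omega)
  simp only [Finset.mem_insert, not_or] at hr
  refine ⟨(insert x (insert y F) ∪ insert q (insert r F) : Finset Ω), Finset.finite_toSet _, p,
    ?_, fun g hg hfix => ?_⟩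
  · simp [hp, hqp.symm, Ne.symm hr.2.1]
  · have hfix' : ∀ z ∈ insert x (insert y F) ∪ insert q (insert r F), g z = z := hfix
    refine hinter _ (hL.apply_mem_line (hcard hx.1 hx.2 hy) hl ?_ hg
        (fun z hz => hfix' z (Finset.mem_union_left _ hz)) hpl)
      (hL.apply_mem_line (hcard (Ne.symm hr.1) hqF hr.2.2) hm ?_ hg
        (fun z hz => hfix' z (Finset.mem_union_right _ hz)) hpm) fun hgF => ?_
    · simp [Set.insert_subset_iff, *]
    · simp [Set.insert_subset_iff, *]
    · have : g p = p := hg.1.1 (hfix' _ (by simp [hgF]))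
      exact hp.2.2 (this ▸ hgF)
end
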